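/- Let (A,{·,·,·}) be a 3-pre-Lie algebra over a field of characteristic zero. Then the induced 3-commutator [x,y,z]_C := {x,y,z} + {y,z,x} + {z,x,y} defines a 3-Lie algebra structure on A. -/

import Mathlib

/-- The 3-commutator `[x,y,z]_C = {x,y,z} + {y,z,x} + {z,x,y}` of a trilinear map. -/
def cBr {k A : Type*} [Field k] [AddCommGroup A] [Module k A]
    (p : A →ₗ[k] A →ₗ[k] A →ₗ[k] A) (x y z : A) : A :=
  p x y z + p y z x + p z x y

/-- the induced 3-commutator `[x,y,z]_C = {x,y,z} + {y,z,x} + {z,x,y}` of a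
3-pre-Lie algebra defines a 3-Lie algebra structure. -/
theorem stmt11 {k A : Type*} [Field k] [CharZero k] [AddCommGroup A] [Module k A]
    (p : A →ₗ[k] A →ₗ[k] A →ₗ[k] A)
    (hpskew : ∀ x y z : A, p x y z = - p y x z)
    (hp1 : ∀ x1 x2 x3 x4 x5 : A,
      p x1 x2 (p x3 x4 x5) =
        p (cBr p x1 x2 x3) x4 x5 + p x3 (cBr p x1 x2 x4) x5 + p x3 x4 (p x1 x2 x5))
    (hp2 : ∀ x1 x2 x3 x4 x5 : A,
      p (cBr p x1 x2 x3) x4 x5 =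
        p x1 x2 (p x3 x4 x5) + p x2 x3 (p x1 x4 x5) + p x3 x1 (p x2 x4 x5)) :
    (∀ x y z : A, cBr p x y z = - cBr p y x z) ∧
    (∀ x y z : A, cBr p x y z = - cBr p x z y) ∧
    (∀ x1 x2 x3 x4 x5 : A,
      cBr p x1 x2 (cBr p x3 x4 x5) =
        cBr p (cBr p x1 x2 x3) x4 x5 + cBr p x3 (cBr p x1 x2 x4) x5
        + cBr p x3 x4 (cBr p x1 x2 x5)) := by
  refine ⟨fun x y z => ?_, fun x y z => ?_, fun x1 x2 x3 x4 x5 => ?_⟩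
  · simp only [cBr]
    rw [hpskew y x z, hpskew x z y, hpskew z y x]
    abel
  · simp only [cBr]
    rw [hpskew x z y, hpskew z y x, hpskew y x z]
    abel
  · -- cyclic sum of the first identity over the last three arguments
    have h := congrArg₂ (· + ·) (congrArg₂ (· + ·) (hp1 x1 x2 x3 x4 x5) (hp1 x1 x2 x4 x5 x3))
      (hp1 x1 x2 x5 x3 x4)
    have rotate : ∀ x y z : A, cBr p x y z = cBr p y z x := fun x y z => by
      simp only [cBr]
      abel
    have expand : ∀ a b c d e : A, cBr p (cBr p a b c) d e =
        p (cBr p a b c) d e - p (cBr p a b c) e d +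
          (p d e (p a b c) + p d e (p b c a) + p d e (p c a b)) := fun a b c d e => by
      rw [cBr, hpskew e]
      simp only [cBr, map_add]
      abel
    rw [← rotate (cBr p x3 x4 x5) x1 x2, rotate x3 (cBr p x1 x2 x4),
      ← rotate (cBr p x1 x2 x5) x3 x4]
    simp only [expand]
    rw [hpskew x3 (cBr p x1 x2 x4), hpskew x4 (cBr p x1 x2 x5), hpskew x5 (cBr p x1 x2 x3)] at h
    simp only [hp2] at h ⊢
    simp only [hpskew x3 x1, hpskew x4 x1, hpskew x5 x1, hpskew x3 x2,
      hpskew x4 x2, hpskew x5 x2, hpskew x4 x3, hpskew x5 x3, hpskew x5 x4, map_neg] at h ⊢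
    linear_combination (norm := module) h
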